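/- Let n ≥ 3 and let p ∈ ℂ[x_1, ..., x_n] be invariant under the shifted S_n-action p(w(μ + ρ) - ρ) = p(μ) where ρ = (n-1, n-2, ..., 0). Assume additionally that for every pair i ≠ j and every μ with (μ + ρ)_i - (μ + ρ)_j = 1, one has p(μ + t(ε_i + ε_j)) = p(μ) for all t ∈ ℂ. Then p is constant on the set ⋃_{i ≠ j} l_{i,j}, where l_{i,j} = {μ ∈ ℂ^n : (μ+ρ)_i - (μ+ρ)_j = 1}. -/

import Mathlib

open MvPolynomial

/-- A univariate polynomial over `ℂ` which is periodic with period `2` is constant. -/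
theorem Polynomial.eval_eq_eval_of_periodic_two (q : Polynomial ℂ)
    (h : ∀ c, q.eval (c + 2) = q.eval c) (a b : ℂ) : q.eval a = q.eval b := by
  have hN : ∀ m : ℕ, q.eval (2 * (m : ℂ)) = q.eval 0 := by
    intro m
    induction m with
    | zero => simp
    | succ m ih => rw [← ih, ← h (2 * (m : ℂ))]; push_cast; ring_nf
  have hq : q = Polynomial.C (q.eval 0) := by
    apply Polynomial.eq_of_infinite_eval_eq
    apply (Set.infinite_range_of_injective
      (f := fun m : ℕ => 2 * (m : ℂ)) fun m k hmk => by simpa using hmk).mono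
    rintro _ ⟨m, rfl⟩
    simpa using hN m
  rw [hq]
  simp

/-- Restricting a polynomial function to a coordinate line gives a univariate polynomial. -/
theorem MvPolynomial.exists_eval_update {σ : Type*} [DecidableEq σ] (p : MvPolynomial σ ℂ)
    (ρ x : σ → ℂ) (k : σ) :
    ∃ q : Polynomial ℂ, ∀ c, q.eval c = eval (Function.update x k c - ρ) p := by
  refine ⟨aeval (fun l => Function.update (fun l => Polynomial.C (x l)) k Polynomial.X l -
    Polynomial.C (ρ l)) p, fun c => ?_⟩
  rw [← Polynomial.coe_evalRingHom, aeval_def, hom_eval₂, eval, coe_eval₂Hom]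
  congr 1
  · ext z
    simp
  · ext l
    by_cases hl : l = k
    · subst hl; simp
    · simp [hl]

/-- The symmetric group acts transitively on ordered pairs of distinct points. -/
theorem Equiv.Perm.exists_map_pair {σ : Type*} [DecidableEq σ] {i j i' j' : σ} (h : i ≠ j)
    (h' : i' ≠ j') : ∃ w : Equiv.Perm σ, w i = i' ∧ w j = j' := by
  have ha : i ≠ Equiv.swap i i' j' := fun hc => h' <| by
    have := congrArg (Equiv.swap i i') hc
    simpa using this
  refine ⟨Equiv.swap i i' * Equiv.swap j (Equiv.swap i i' j'), ?_, ?_⟩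
  · simp [Equiv.swap_apply_of_ne_of_ne h ha]
  · simp

/-- On the hyperplane `x i - x j = 1`, a symmetric function constant along the lines in direction
`ε_i + ε_j` is periodic of period `2` in every other coordinate. -/
theorem update_add_two_of_symmetric {σ : Type*} [DecidableEq σ] {F : (σ → ℂ) → ℂ}
    (hsymm : ∀ (w : Equiv.Perm σ) x, F (x ∘ w) = F x)
    (hline : ∀ i j, i ≠ j → ∀ x : σ → ℂ, x i - x j = 1 → ∀ t : ℂ,
      F (fun l => x l + t * ((if l = i then 1 else 0) + (if l = j then 1 else 0))) = F x)
    {i j k : σ} (hij : i ≠ j) (hki : k ≠ i) (hkj : k ≠ j) (x : σ → ℂ) (hx : x i - x j = 1) (c : ℂ) :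
    F (Function.update x k (c + 2)) = F (Function.update x k c) := by
  have h1 := hline i j hij (Function.update x k c) (by simp [hki.symm, hkj.symm, hx])
    (c + 1 - x j)
  have h2 := hline j k hkj.symm
    (fun l => Function.update x k c l +
      (c + 1 - x j) * ((if l = i then 1 else 0) + (if l = j then 1 else 0)))
    (by simp [hki, hkj, hkj.symm, hij.symm]) (x j - c)
  rw [← h1, ← h2, ← hsymm (Equiv.swap i j * Equiv.swap i k)]
  congr 1
  ext l
  have hxi : x i = x j + 1 := by linear_combination hx
  rcases eq_or_ne l i with rfl | hli
  · simp [hij, hki, hki.symm, hkj, Equiv.swap_apply_of_ne_of_ne, hxi]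
    ring
  rcases eq_or_ne l j with rfl | hlj
  · simp [hij.symm, hki.symm, hkj.symm, Equiv.swap_apply_of_ne_of_ne, hxi]
    ring
  rcases eq_or_ne l k with rfl | hlk
  · simp [hki, hkj, hkj.symm]
  · simp [hli, hlj, hlk, Equiv.swap_apply_of_ne_of_ne]

/-- A symmetric polynomial function constant along the lines in direction `ε_i + ε_j` is constant
on the hyperplane `x i - x j = 1`. -/
theorem eq_of_mem_hyperplane {σ : Type*} [Fintype σ] [DecidableEq σ] {F : (σ → ℂ) → ℂ}
    (hsymm : ∀ (w : Equiv.Perm σ) x, F (x ∘ w) = F x)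
    (hline : ∀ i j, i ≠ j → ∀ x : σ → ℂ, x i - x j = 1 → ∀ t : ℂ,
      F (fun l => x l + t * ((if l = i then 1 else 0) + (if l = j then 1 else 0))) = F x)
    (hpoly : ∀ x k, ∃ q : Polynomial ℂ, ∀ c, q.eval c = F (Function.update x k c))
    {i j : σ} (hij : i ≠ j) (x z : σ → ℂ) (hx : x i - x j = 1) (hz : z i - z j = 1) :
    F x = F z := by
  have hs : ∀ s : Finset σ, i ∉ s → j ∉ s → F (fun l => if l ∈ s then z l else x l) = F x := by
    intro s
    induction s using Finset.induction_on with
    | empty => simp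
    | insert k s hk ih =>
      intro hi hj
      rw [Finset.mem_insert, not_or] at hi hj
      rw [← ih hi.2 hj.2]
      set y : σ → ℂ := fun l => if l ∈ s then z l else x l with hy
      have hyij : y i - y j = 1 := by simp [hy, hi.2, hj.2, hx]
      have hzk : (fun l => if l ∈ insert k s then z l else x l) = Function.update y k (z k) := by
        ext l
        by_cases hl : l = k
        · subst hl; simp
        · simp [hl, hy]
      obtain ⟨q, hq⟩ := hpoly y k
      rw [hzk, ← hq, q.eval_eq_eval_of_periodic_two _ (z k) (y k), hq, Function.update_eq_self]
      intro c
      rw [hq, hq]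
      exact update_add_two_of_symmetric hsymm hline hij (Ne.symm hi.1) (Ne.symm hj.1) y hyij c
  rw [← hs (Finset.univ \ {i, j}) (by simp) (by simp),
    ← hline i j hij _ (by simpa using hx) (z j - x j)]
  congr 1
  ext l
  rcases eq_or_ne l i with rfl | hli
  · simp [hij]
    linear_combination hx - hz
  rcases eq_or_ne l j with rfl | hlj
  · simp [hij.symm]
  · simp [hli, hlj]

/-- Lemma 4.4: if `p` is invariant under the shifted `S_n`-action
(`ρ = (n-1, n-2, …, 0)`) and is constant along the lines `μ + t(ε_i + ε_j)`
through any point of the atypicality hyperplane `l_{i,j}`, then `p` is constant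
on `⋃_{i ≠ j} l_{i,j}`. -/
theorem stmt_16 (n : ℕ) (hn : 3 ≤ n)
    (ρ : Fin n → ℂ) (hρ : ∀ i : Fin n, ρ i = (n : ℂ) - 1 - (i : ℕ))
    (p : MvPolynomial (Fin n) ℂ)
    (hinv : ∀ (w : Equiv.Perm (Fin n)) (μ : Fin n → ℂ),
      eval (fun i => (μ (w⁻¹ i) + ρ (w⁻¹ i)) - ρ i) p = eval μ p)
    (hline : ∀ (i j : Fin n), i ≠ j → ∀ μ : Fin n → ℂ,
      (μ i + ρ i) - (μ j + ρ j) = 1 →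
      ∀ t : ℂ,
        eval (fun l => μ l + t * ((if l = i then 1 else 0) +
          (if l = j then 1 else 0))) p = eval μ p) :
    ∀ μ ν : Fin n → ℂ,
      (∃ i j : Fin n, i ≠ j ∧ (μ i + ρ i) - (μ j + ρ j) = 1) →
      (∃ i j : Fin n, i ≠ j ∧ (ν i + ρ i) - (ν j + ρ j) = 1) →
      eval μ p = eval ν p := by
  have hsymm : ∀ (w : Equiv.Perm (Fin n)) (x : Fin n → ℂ),
      eval (x ∘ w - ρ) p = eval (x - ρ) p := by
    intro w x
    rw [← hinv w⁻¹ (x - ρ)]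
    congr 2
    ext l
    simp
  have hline' : ∀ i j, i ≠ j → ∀ x : Fin n → ℂ, x i - x j = 1 → ∀ t : ℂ,
      eval ((fun l => x l + t * ((if l = i then 1 else 0) + (if l = j then 1 else 0))) - ρ) p =
        eval (x - ρ) p := by
    intro i j hij x hx t
    rw [← hline i j hij (x - ρ) (by simpa using hx) t]
    congr 2
    ext l
    simp only [Pi.sub_apply]
    ring
  rintro μ ν ⟨i, j, hij, hμ⟩ ⟨i', j', hij', hν⟩
  obtain ⟨w, hwi, hwj⟩ := Equiv.Perm.exists_map_pair hij hij'
  have h := eq_of_mem_hyperplane (F := fun x => eval (x - ρ) p) hsymm hline'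
    (p.exists_eval_update ρ) hij (μ + ρ) ((ν + ρ) ∘ w) hμ (by simpa [hwi, hwj] using hν)
  simpa only [hsymm, add_sub_cancel_right] using h
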